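/- For $P_{Y^n} = \mathcal{N}(0, I_n)$ and any $P_{Z^n} \ll P_{Y^n}$ with finite second moment and finite differential entropy, the quadratic Wasserstein distance satisfies $W_2^2(P_{Z^n}, P_{Y^n}) \leq \mathbb{E}[\|Z^n\|^2] + n - 2n\sqrt{\frac{1}{2\pi e} e^{\frac{2}{n}h(Z^n)}}$, with equality when $P_{Z^n} = \mathcal{N}(\mu, \sigma^2 I_n)$ for some $\mu \in \mathbb{R}^n$ and $\sigma > 0$. -/

import Mathlib

open MeasureTheory Real

noncomputable def stdGaussianDensity (n : ℕ) (x : EuclideanSpace ℝ (Fin n)) : ℝ :=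
  (2 * π) ^ (-(n : ℝ) / 2) * Real.exp (-‖x‖ ^ 2 / 2)

noncomputable def stdGaussian (n : ℕ) : Measure (EuclideanSpace ℝ (Fin n)) :=
  volume.withDensity fun x => ENNReal.ofReal (stdGaussianDensity n x)

def IsCoupling {α β : Type*} [MeasurableSpace α] [MeasurableSpace β]
    (P : Measure (α × β)) (μ : Measure α) (ν : Measure β) : Prop :=
  P.map Prod.fst = μ ∧ P.map Prod.snd = ν

section OneDimensional

open ProbabilityTheory hiding stdGaussian
open Set Filter Topology

lemma continuous_cdf (ν : Measure ℝ) [IsProbabilityMeasure ν] [NullSingletonClass ν] :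
    Continuous (cdf ν) := by
  refine continuous_iff_continuousAt.2 fun x => ?_
  rw [(cdf ν).mono.continuousAt_iff_leftLim_eq_rightLim, (cdf ν).rightLim_eq]
  have h := (cdf ν).measure_singleton x
  rw [measure_cdf, measure_singleton, eq_comm, ENNReal.ofReal_eq_zero] at h
  exact le_antisymm ((cdf ν).mono.leftLim_le le_rfl) (by linarith)

lemma exists_cdf_eq (ν : Measure ℝ) [IsProbabilityMeasure ν] [NullSingletonClass ν] {u : ℝ}
    (hu : u ∈ Ioo (0 : ℝ) 1) : ∃ t, cdf ν t = u :=
  mem_range_of_exists_le_of_exists_ge (continuous_cdf ν)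
    ((tendsto_cdf_atBot ν).eventually_le_const hu.1).exists
    ((tendsto_cdf_atTop ν).eventually_const_le hu.2).exists

/-- The probability integral transform: the distribution function of an atomless law, evaluated at
a sample, is uniform on the unit interval. -/
lemma measure_cdf_le (ν : Measure ℝ) [IsProbabilityMeasure ν] [NullSingletonClass ν] {u : ℝ}
    (hu : u ∈ Ioo (0 : ℝ) 1) : ν {t | cdf ν t ≤ u} = ENNReal.ofReal u := by
  obtain ⟨t₀, ht₀⟩ := exists_cdf_eq ν hu
  obtain ⟨b, hb⟩ := ((tendsto_cdf_atTop ν).eventually_const_lt hu.2).exists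
  have hbdd : BddAbove {t | cdf ν t ≤ u} :=
    ⟨b, fun t ht => not_lt.1 fun h => (hb.trans_le ((cdf ν).mono h.le)).not_ge ht⟩
  have hclosed : IsClosed {t | cdf ν t ≤ u} := isClosed_le (continuous_cdf ν) continuous_const
  have hmem := hclosed.csSup_mem ⟨t₀, ht₀.le⟩ hbdd
  set t₁ := sSup {t | cdf ν t ≤ u}
  have hset : {t | cdf ν t ≤ u} = Iic t₁ :=
    Subset.antisymm (fun t ht => le_csSup hbdd ht) fun t ht => ((cdf ν).mono ht).trans hmem
  have hval : cdf ν t₁ = u :=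
    le_antisymm hmem (ht₀ ▸ (cdf ν).mono (le_csSup hbdd ht₀.le))
  rw [hset, ← ofReal_cdf, hval]

lemma ae_cdf_mem_Ioo (ν : Measure ℝ) [IsProbabilityMeasure ν] [NullSingletonClass ν] :
    ∀ᵐ t ∂ν, cdf ν t ∈ Ioo (0 : ℝ) 1 := by
  have hpos : ∀ᵐ t ∂ν, 0 < cdf ν t := by
    rw [ae_iff, ← nonpos_iff_eq_zero]
    refine ENNReal.le_of_forall_pos_le_add fun ε hε _ => ?_
    have hu : min (ε : ℝ) (1 / 2) ∈ Ioo (0 : ℝ) 1 :=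
      ⟨lt_min hε (by norm_num), (min_le_right _ _).trans_lt (by norm_num)⟩
    calc ν {t | ¬ 0 < cdf ν t} ≤ ν {t | cdf ν t ≤ min (ε : ℝ) (1 / 2)} :=
          measure_mono fun t ht => (not_lt.1 ht).trans hu.1.le
      _ = ENNReal.ofReal (min (ε : ℝ) (1 / 2)) := measure_cdf_le ν hu
      _ ≤ 0 + ε := by
          rw [zero_add, ← ENNReal.ofReal_coe_nnreal]
          exact ENNReal.ofReal_le_ofReal (min_le_left _ _)
  have hlt : ∀ᵐ t ∂ν, cdf ν t < 1 := by
    rw [ae_iff, ← nonpos_iff_eq_zero]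
    refine ENNReal.le_of_forall_pos_le_add fun ε hε _ => ?_
    have hu : 1 - min (ε : ℝ) (1 / 2) ∈ Ioo (0 : ℝ) 1 := by
      have h1 : 0 < min (ε : ℝ) (1 / 2) := lt_min hε (by norm_num)
      have h2 : min (ε : ℝ) (1 / 2) ≤ 1 / 2 := min_le_right _ _
      constructor <;> linarith
    have hmeas : MeasurableSet {t | cdf ν t ≤ 1 - min (ε : ℝ) (1 / 2)} :=
      measurableSet_le (continuous_cdf ν).measurable measurable_const
    calc ν {t | ¬ cdf ν t < 1} ≤ ν {t | cdf ν t ≤ 1 - min (ε : ℝ) (1 / 2)}ᶜ :=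
          measure_mono fun t ht h => ht (lt_of_le_of_lt h hu.2)
      _ = ENNReal.ofReal (min (ε : ℝ) (1 / 2)) := by
          rw [prob_compl_eq_one_sub hmeas, measure_cdf_le ν hu, ← ENNReal.ofReal_one,
            ← ENNReal.ofReal_sub _ hu.1.le, sub_sub_cancel]
      _ ≤ 0 + ε := by
          rw [zero_add, ← ENNReal.ofReal_coe_nnreal]
          exact ENNReal.ofReal_le_ofReal (min_le_left _ _)
  filter_upwards [hpos, hlt] with t h1 h2 using ⟨h1, h2⟩

instance : NullSingletonClass (gaussianReal 0 1) := nullSingletonClass_gaussianReal one_ne_zero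

lemma strictMono_cdf_gaussianReal : StrictMono (cdf (gaussianReal 0 1)) := by
  intro x y hxy
  have h := (cdf (gaussianReal 0 1)).measure_Ioc x y
  rw [measure_cdf] at h
  have hne : gaussianReal 0 1 (Ioc x y) ≠ 0 := fun h0 => by
    have := gaussianReal_absolutelyContinuous' 0 one_ne_zero h0
    rw [Real.volume_Ioc, ENNReal.ofReal_eq_zero] at this
    linarith
  rw [h, ne_eq, ENNReal.ofReal_eq_zero, not_le] at hne
  linarith

open Classical in
/-- The quantile function of the standard Gaussian law, set to zero outside of `(0, 1)`. -/
noncomputable def gaussianQuantile (u : ℝ) : ℝ :=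
  if h : u ∈ Ioo (0 : ℝ) 1 then (exists_cdf_eq (gaussianReal 0 1) h).choose else 0

lemma cdf_gaussianQuantile {u : ℝ} (hu : u ∈ Ioo (0 : ℝ) 1) :
    cdf (gaussianReal 0 1) (gaussianQuantile u) = u := by
  rw [gaussianQuantile, dif_pos hu]
  exact (exists_cdf_eq (gaussianReal 0 1) hu).choose_spec

lemma gaussianQuantile_le_iff {u : ℝ} (hu : u ∈ Ioo (0 : ℝ) 1) (y : ℝ) :
    gaussianQuantile u ≤ y ↔ u ≤ cdf (gaussianReal 0 1) y := by
  rw [← strictMono_cdf_gaussianReal.le_iff_le, cdf_gaussianQuantile hu]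

lemma measurable_gaussianQuantile : Measurable gaussianQuantile := by
  refine measurable_of_Iic fun y => ?_
  have : gaussianQuantile ⁻¹' Iic y =
      (Ioo 0 1 ∩ Iic (cdf (gaussianReal 0 1) y)) ∪ ((Ioo 0 1)ᶜ ∩ {_u | 0 ≤ y}) := by
    ext u
    by_cases hu : u ∈ Ioo (0 : ℝ) 1
    · simp only [mem_preimage, mem_Iic, gaussianQuantile_le_iff hu, mem_union, mem_inter_iff, hu,
        true_and, mem_compl_iff, not_true, false_and, or_false]
    · have h0 : gaussianQuantile u = 0 := by rw [gaussianQuantile, dif_neg hu]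
      simp only [mem_preimage, mem_Iic, h0, mem_union, mem_inter_iff, hu, false_and, false_or,
        mem_compl_iff, not_false_iff, true_and, mem_ofPred_eq]
  rw [this]
  exact (measurableSet_Ioo.inter measurableSet_Iic).union
    (measurableSet_Ioo.compl.inter (MeasurableSet.const _))

lemma cdf_gaussianReal_mem_Ioo (y : ℝ) : cdf (gaussianReal 0 1) y ∈ Ioo (0 : ℝ) 1 :=
  ⟨(cdf_nonneg _ (y - 1)).trans_lt (strictMono_cdf_gaussianReal (by linarith)),
    (strictMono_cdf_gaussianReal (by linarith)).trans_le (cdf_le_one _ (y + 1))⟩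

lemma map_gaussianQuantile_cdf (ν : Measure ℝ) [IsProbabilityMeasure ν] [NullSingletonClass ν] :
    ν.map (fun t => gaussianQuantile (cdf ν t)) = gaussianReal 0 1 := by
  have hm : Measurable fun t => gaussianQuantile (cdf ν t) :=
    measurable_gaussianQuantile.comp (continuous_cdf ν).measurable
  have := Measure.isProbabilityMeasure_map (μ := ν) hm.aemeasurable
  refine Measure.ext_of_Iic _ _ fun y => ?_
  rw [Measure.map_apply hm measurableSet_Iic, ← ofReal_cdf,
    ← measure_cdf_le ν (cdf_gaussianReal_mem_Ioo y)]
  refine measure_congr ?_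
  filter_upwards [ae_cdf_mem_Ioo ν] with t ht
  exact propext (gaussianQuantile_le_iff ht y)

lemma setIntegral_Ioi_id_gaussianReal (s : ℝ) :
    ∫ y in Ioi s, y ∂gaussianReal 0 1 = gaussianPDFReal 0 1 s := by
  have hint : Integrable (fun y => gaussianPDFReal 0 1 y * y) := by
    have h := (memLp_id_gaussianReal (μ := 0) (v := 1) 1).integrable le_rfl
    rw [gaussianReal_of_var_ne_zero _ one_ne_zero, gaussianPDF_def,
      integrable_withDensity_iff_integrable_smul₀' (by fun_prop) (by simp)] at h
    refine h.congr (ae_of_all _ fun y => ?_)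
    simp [gaussianPDFReal_nonneg]
  have hderiv : ∀ y,
      HasDerivAt (fun y => -gaussianPDFReal 0 1 y) (gaussianPDFReal 0 1 y * y) y := by
    intro y
    have h1 : HasDerivAt (fun y : ℝ => -(y - 0) ^ 2 / (2 * ((1 : NNReal) : ℝ))) (-y) y := by
      have := (((hasDerivAt_id y).sub_const 0).pow 2).neg.div_const (2 * ((1 : NNReal) : ℝ))
      refine this.congr_deriv ?_
      simp
      ring
    refine ((h1.exp.const_mul (√(2 * π * ((1 : NNReal) : ℝ)))⁻¹).neg).congr_deriv ?_
    rw [gaussianPDFReal]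
    ring
  have hlim : Tendsto (fun y => -gaussianPDFReal 0 1 y) atTop (𝓝 0) := by
    have h1 : Tendsto (fun y : ℝ => -(y - 0) ^ 2 / (2 * ((1 : NNReal) : ℝ))) atTop atBot := by
      simp only [neg_div, sub_zero, NNReal.coe_one, mul_one]
      exact tendsto_neg_atTop_atBot.comp
        ((tendsto_pow_atTop two_ne_zero).atTop_div_const two_pos)
    simpa [gaussianPDFReal_def] using
      ((Real.tendsto_exp_atBot.comp h1).const_mul (√(2 * π * ((1 : NNReal) : ℝ)))⁻¹).neg
  have h := integral_Ioi_of_hasDerivAt_of_tendsto' (a := s) (fun y _ => hderiv y)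
    hint.integrableOn hlim
  rw [zero_sub, neg_neg] at h
  rw [← h, gaussianReal_of_var_ne_zero _ one_ne_zero, gaussianPDF_def,
    restrict_withDensity measurableSet_Ioi,
    integral_withDensity_eq_integral_toReal_smul (by fun_prop) (by simp)]
  simp [gaussianPDFReal_nonneg]

lemma integrable_and_integral_integral_Ioi (ν : Measure ℝ) [IsFiniteMeasure ν] {Y : ℝ → ℝ}
    (hY : Integrable Y ν) (hXY : Integrable (fun t => t * Y t) ν) (h0 : ∫ t, Y t ∂ν = 0) :
    Integrable (fun z => ∫ t in Ioi z, Y t ∂ν) ∧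
      ∫ z, ∫ t in Ioi z, Y t ∂ν = ∫ t, t * Y t ∂ν := by
  set χ : ℝ → ℝ → ℝ := fun t z => (Ico 0 t).indicator 1 z - (Ico t 0).indicator 1 z with hχ
  have hχm : Measurable (Function.uncurry χ) := by
    have h1 : MeasurableSet {p : ℝ × ℝ | p.2 ∈ Ico 0 p.1} :=
      (measurableSet_le measurable_const measurable_snd).inter
        (measurableSet_lt measurable_snd measurable_fst)
    have h2 : MeasurableSet {p : ℝ × ℝ | p.2 ∈ Ico p.1 0} :=
      (measurableSet_le measurable_fst measurable_snd).inter
        (measurableSet_lt measurable_snd measurable_const)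
    exact ((measurable_const (a := (1 : ℝ))).indicator h1).sub
      ((measurable_const (a := (1 : ℝ))).indicator h2)
  have hind : ∀ a b : ℝ, Integrable ((Ico a b).indicator (1 : ℝ → ℝ)) := fun a b =>
    (integrable_indicator_iff measurableSet_Ico).2 (integrableOn_const (C := (1 : ℝ)) (by simp))
  have hχi : ∀ t, Integrable (χ t) := fun t => (hind _ _).sub (hind _ _)
  have hχint : ∀ t, ∫ z, χ t z = t := by
    intro t
    rw [hχ, integral_sub (hind _ _) (hind _ _), integral_indicator_one measurableSet_Ico,
      integral_indicator_one measurableSet_Ico, Real.volume_real_Ico, Real.volume_real_Ico]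
    rcases le_total 0 t with h | h
    · rw [max_eq_left, max_eq_right] <;> linarith
    · rw [max_eq_right, max_eq_left] <;> linarith
  have hχnorm : ∀ t, ∫ z, ‖χ t z‖ = |t| := by
    intro t
    have : (fun z => ‖χ t z‖) = fun z => (Ico 0 t).indicator 1 z + (Ico t 0).indicator 1 z := by
      ext z
      by_cases h1 : z ∈ Ico 0 t
      · have h2 : z ∉ Ico t 0 := fun h => absurd h1.2 (not_lt.2 h.1)
        simp [hχ, h1, h2]
      · by_cases h2 : z ∈ Ico t 0 <;> simp [hχ, h1, h2]
    rw [this, integral_add (hind _ _) (hind _ _), integral_indicator_one measurableSet_Ico,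
      integral_indicator_one measurableSet_Ico, Real.volume_real_Ico, Real.volume_real_Ico]
    rcases le_total 0 t with h | h
    · rw [max_eq_left, max_eq_right, abs_of_nonneg h] <;> linarith
    · rw [max_eq_right, max_eq_left, abs_of_nonpos h] <;> linarith
  have hprod : Integrable (Function.uncurry fun t z => Y t * χ t z) (ν.prod volume) := by
    have hmeas : AEStronglyMeasurable (Function.uncurry fun t z => Y t * χ t z) (ν.prod volume) :=
      hY.aestronglyMeasurable.comp_fst.mul hχm.aestronglyMeasurable
    refine (integrable_prod_iff hmeas).2 ⟨ae_of_all _ fun t => (hχi t).const_mul (Y t), ?_⟩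
    refine hXY.norm.congr (ae_of_all _ fun t => ?_)
    simp only [Function.uncurry_apply_pair, norm_mul, integral_const_mul, hχnorm]
    rw [Real.norm_eq_abs, mul_comm]
  have hinner : ∀ z, ∫ t, Y t * χ t z ∂ν = ∫ t in Ioi z, Y t ∂ν := by
    intro z
    have : (fun t => Y t * χ t z) =
        fun t => (Ioi z).indicator Y t - (if z < 0 then 1 else 0) * Y t := by
      ext t
      simp only [hχ, indicator_apply, mem_Ico, mem_Ioi, Pi.one_apply]
      split_ifs <;> first | (exfalso; grind) | ring
    rw [this, integral_sub (hY.indicator measurableSet_Ioi) (hY.const_mul _),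
      integral_const_mul, h0,
      mul_zero, sub_zero, integral_indicator measurableSet_Ioi]
  refine ⟨?_, ?_⟩
  · simpa only [Function.uncurry, hinner] using hprod.integral_prod_right
  · simp_rw [← hinner]
    rw [← integral_integral_swap hprod]
    refine integral_congr_ae (ae_of_all _ fun t => ?_)
    simp only [integral_const_mul, hχint, mul_comm]

lemma setIntegral_Ioi_gaussianQuantile_cdf (ν : Measure ℝ) [IsProbabilityMeasure ν]
    [NullSingletonClass ν] {z : ℝ} (hz : cdf ν z ∈ Ioo (0 : ℝ) 1) :
    ∫ t in Ioi z, gaussianQuantile (cdf ν t) ∂ν =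
      gaussianPDFReal 0 1 (gaussianQuantile (cdf ν z)) := by
  have hm : Measurable fun t => gaussianQuantile (cdf ν t) :=
    measurable_gaussianQuantile.comp (continuous_cdf ν).measurable
  have hset : MeasurableSet {t | cdf ν t ≤ cdf ν z} :=
    measurableSet_le (continuous_cdf ν).measurable measurable_const
  have h1 : ({t | cdf ν t ≤ cdf ν z}ᶜ : Set ℝ) =ᵐ[ν] Ioi z := by
    refine ae_eq_of_subset_of_measure_ge
      (fun t ht => not_le.1 fun h => ht ((cdf ν).mono h)) ?_ hset.compl.nullMeasurableSet
      (measure_ne_top _ _)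
    rw [prob_compl_eq_one_sub hset, measure_cdf_le ν hz, ofReal_cdf, ← compl_Iic,
      prob_compl_eq_one_sub measurableSet_Iic]
  have h2 : ({t | cdf ν t ≤ cdf ν z}ᶜ : Set ℝ) =ᵐ[ν]
      (fun t => gaussianQuantile (cdf ν t)) ⁻¹' Ioi (gaussianQuantile (cdf ν z)) := by
    filter_upwards [ae_cdf_mem_Ioo ν] with t ht
    refine propext ?_
    change ¬ (cdf ν t ≤ cdf ν z) ↔ gaussianQuantile (cdf ν z) < gaussianQuantile (cdf ν t)
    rw [← not_le, gaussianQuantile_le_iff ht, cdf_gaussianQuantile hz]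
  rw [← setIntegral_congr_set (h2.symm.trans h1), ← setIntegral_Ioi_id_gaussianReal,
    ← map_gaussianQuantile_cdf ν,
    setIntegral_map (f := fun y : ℝ => y) measurableSet_Ioi aestronglyMeasurable_id hm.aemeasurable]

lemma ofReal_integral_eq_lintegral_sub {Ω : Type*} [MeasurableSpace Ω] {P : Measure Ω} {h : Ω → ℝ}
    (hh : Integrable h P) :
    ENNReal.ofReal (∫ x, h x ∂P) =
      ∫⁻ x, ENNReal.ofReal (h x) ∂P - ∫⁻ x, ENNReal.ofReal (-h x) ∂P := by
  have hneg : ∫⁻ x, ENNReal.ofReal (-h x) ∂P ≠ ⊤ := hh.neg.lintegral_lt_top.ne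
  rw [integral_eq_lintegral_pos_part_sub_lintegral_neg_part hh,
    ENNReal.ofReal_sub _ ENNReal.toReal_nonneg, ENNReal.ofReal_toReal hh.lintegral_lt_top.ne,
    ENNReal.ofReal_toReal hneg]

/-- The one-dimensional monotone coupling with the standard Gaussian has correlation at least the
integral of the Gaussian density along the transport map. -/
lemma lintegral_gaussianPDF_gaussianQuantile_le (ν : Measure ℝ) [IsProbabilityMeasure ν]
    [NullSingletonClass ν] (h2 : Integrable (fun t => t ^ 2) ν) :
    (∫⁻ t in {t | cdf ν t ∈ Ioo (0 : ℝ) 1}, gaussianPDF 0 1 (gaussianQuantile (cdf ν t))) +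
        ∫⁻ t, ENNReal.ofReal (-(t * gaussianQuantile (cdf ν t))) ∂ν ≤
      ∫⁻ t, ENNReal.ofReal (t * gaussianQuantile (cdf ν t)) ∂ν := by
  set T : ℝ → ℝ := fun t => gaussianQuantile (cdf ν t) with hT
  have hm : Measurable T := measurable_gaussianQuantile.comp (continuous_cdf ν).measurable
  have hmap : ν.map T = gaussianReal 0 1 := map_gaussianQuantile_cdf ν
  have hT2 : MemLp T 2 ν :=
    (memLp_map_measure_iff aestronglyMeasurable_id hm.aemeasurable).1
      (hmap ▸ memLp_id_gaussianReal 2)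
  have hid2 : MemLp (fun t : ℝ => t) 2 ν :=
    (memLp_two_iff_integrable_sq aestronglyMeasurable_id).2 h2
  have hTint : ∫ t, T t ∂ν = 0 := by
    have := integral_map (μ := ν) hm.aemeasurable (f := fun y : ℝ => y) aestronglyMeasurable_id
    rw [← this, hmap, integral_id_gaussianReal]
  obtain ⟨hHi, hH⟩ := integrable_and_integral_integral_Ioi ν (hT2.integrable one_le_two)
    (hid2.integrable_mul hT2) hTint
  have hmeas : MeasurableSet {t | cdf ν t ∈ Ioo (0 : ℝ) 1} :=
    (continuous_cdf ν).measurable measurableSet_Ioo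
  have hpos : ∀ z, 0 ≤ ∫ t in Ioi z, T t ∂ν := by
    intro z
    by_cases hz : cdf ν z ∈ Ioo (0 : ℝ) 1
    · rw [setIntegral_Ioi_gaussianQuantile_cdf ν hz]
      exact gaussianPDFReal_nonneg _ _ _
    · have hcompl : ν (Ioi z) = 1 - ENNReal.ofReal (cdf ν z) := by
        rw [ofReal_cdf, ← compl_Iic, prob_compl_eq_one_sub measurableSet_Iic]
      have hcases : cdf ν z = 0 ∨ cdf ν z = 1 := by
        by_contra! h
        exact hz ⟨(cdf_nonneg ν z).lt_of_ne' h.1, (cdf_le_one ν z).lt_of_ne h.2⟩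
      rcases hcases with h | h
      · have : Ioi z =ᵐ[ν] univ := by
          rw [ae_eq_univ, compl_Ioi, ← ofReal_cdf, h, ENNReal.ofReal_zero]
        rw [setIntegral_congr_set this, setIntegral_univ, hTint]
      · rw [Measure.restrict_eq_zero.2 (by rw [hcompl, h]; simp), integral_zero_measure]
  have hXY : Integrable (fun t => t * T t) ν := hid2.integrable_mul hT2
  have hle : ∫⁻ t, ENNReal.ofReal (-(t * T t)) ∂ν ≤ ∫⁻ t, ENNReal.ofReal (t * T t) ∂ν := by
    have h := integral_eq_lintegral_pos_part_sub_lintegral_neg_part hXY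
    rw [← hH] at h
    refine (ENNReal.toReal_le_toReal hXY.neg.lintegral_lt_top.ne hXY.lintegral_lt_top.ne).1 ?_
    exact sub_nonneg.1 (h ▸ integral_nonneg hpos)
  rw [← tsub_add_cancel_of_le hle, ← ofReal_integral_eq_lintegral_sub hXY]
  gcongr ?_ + _
  calc ∫⁻ t in {t | cdf ν t ∈ Ioo (0 : ℝ) 1}, gaussianPDF 0 1 (T t)
      = ∫⁻ z in {t | cdf ν t ∈ Ioo (0 : ℝ) 1}, ENNReal.ofReal (∫ t in Ioi z, T t ∂ν) :=
        setLIntegral_congr_fun hmeas fun z hz => by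
          rw [setIntegral_Ioi_gaussianQuantile_cdf ν hz, gaussianPDF]
    _ ≤ ∫⁻ z, ENNReal.ofReal (∫ t in Ioi z, T t ∂ν) := setLIntegral_le_lintegral _ _
    _ = ENNReal.ofReal (∫ t, t * T t ∂ν) := by
        rw [← ofReal_integral_eq_lintegral_ofReal hHi (ae_of_all _ hpos), hH]

end OneDimensional

section Fibered

open ProbabilityTheory hiding stdGaussian
open Set Filter Topology
open scoped ENNReal

variable {α : Type*}

/-- The density of the first coordinate conditionally on the second one. -/
noncomputable def condDensity (g : ℝ × α → ℝ≥0∞) (a : α) (t : ℝ) : ℝ≥0∞ :=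
  g (t, a) / ∫⁻ s, g (s, a)

/-- The fiberwise monotone map onto the standard Gaussian law. -/
noncomputable def fiberTransport (g : ℝ × α → ℝ≥0∞) (p : ℝ × α) : ℝ :=
  gaussianQuantile (∫⁻ s in Iic p.1, condDensity g p.2 s).toReal

variable {g : ℝ × α → ℝ≥0∞}

lemma fiberTransport_eq {a : α} [IsProbabilityMeasure (volume.withDensity (condDensity g a))]
    (t : ℝ) :
    fiberTransport g (t, a) =
      gaussianQuantile (cdf (volume.withDensity (condDensity g a)) t) := by
  rw [fiberTransport, cdf_eq_real, measureReal_def, withDensity_apply _ measurableSet_Iic]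

variable [MeasurableSpace α]

lemma measurable_condDensity (hg : Measurable g) :
    Measurable fun p : ℝ × α => condDensity g p.2 p.1 :=
  hg.div ((hg.lintegral_prod_left' (μ := volume)).comp measurable_snd)

lemma measurable_fiberTransport (hg : Measurable g) : Measurable (fiberTransport g) := by
  refine measurable_gaussianQuantile.comp (Measurable.ennreal_toReal ?_)
  have hset : MeasurableSet {q : ℝ × (ℝ × α) | q.1 ≤ q.2.1} :=
    measurableSet_le measurable_fst (measurable_fst.comp measurable_snd)
  have hm : Measurable fun q : ℝ × (ℝ × α) => condDensity g q.2.2 q.1 :=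
    (measurable_condDensity hg).comp (measurable_fst.prodMk (measurable_snd.comp measurable_snd))
  have h := (hm.indicator hset).lintegral_prod_left' (μ := (volume : Measure ℝ))
  refine (congrArg Measurable (funext fun p => ?_)).mp h
  rw [← lintegral_indicator measurableSet_Iic]
  rfl

lemma isProbabilityMeasure_condDensity (hg : Measurable g) {a : α}
    (h0 : ∫⁻ s, g (s, a) ≠ 0) (htop : ∫⁻ s, g (s, a) ≠ ∞) :
    IsProbabilityMeasure (volume.withDensity (condDensity g a)) := by
  constructor
  simp only [condDensity, withDensity_apply _ MeasurableSet.univ, Measure.restrict_univ,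
    div_eq_mul_inv]
  have hm : Measurable fun s => g (s, a) := hg.comp measurable_prodMk_right
  rw [lintegral_mul_const _ hm, ENNReal.mul_inv_cancel h0 htop]

variable {ρ : Measure α} [SFinite ρ]

lemma lintegral_prod_withDensity (hg : Measurable g) (hfin : ∀ᵐ a ∂ρ, ∫⁻ s, g (s, a) ≠ ∞)
    {k : ℝ × α → ℝ≥0∞} (hk : Measurable k) :
    ∫⁻ p, k p ∂(volume.prod ρ).withDensity g =
      ∫⁻ a, ∫⁻ t, k (t, a) ∂volume.withDensity (condDensity g a)
        ∂ρ.withDensity fun a => ∫⁻ s, g (s, a) := by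
  have hga : ∀ a, Measurable fun s => g (s, a) := fun a => hg.comp measurable_prodMk_right
  have hka : ∀ a, Measurable fun s => k (s, a) := fun a => hk.comp measurable_prodMk_right
  have hca : ∀ a, Measurable (condDensity g a) := fun a =>
    (measurable_condDensity hg).comp measurable_prodMk_right
  have hm1 : Measurable fun a => ∫⁻ s, g (s, a) := hg.lintegral_prod_left'
  have hin : ∀ a, ∫⁻ t, k (t, a) ∂volume.withDensity (condDensity g a) =
      ∫⁻ t, condDensity g a t * k (t, a) := fun a =>
    lintegral_withDensity_eq_lintegral_mul _ (hca a) (hka a)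
  simp_rw [hin]
  have hm2 : Measurable fun a => ∫⁻ t, condDensity g a t * k (t, a) :=
    ((measurable_condDensity hg).mul hk).lintegral_prod_left'
  rw [lintegral_withDensity_eq_lintegral_mul _ hg hk,
    lintegral_prod_symm _ (hg.mul hk).aemeasurable,
    lintegral_withDensity_eq_lintegral_mul _ hm1 hm2]
  refine lintegral_congr_ae ?_
  filter_upwards [hfin] with a ha
  simp only [Pi.mul_apply]
  have hck : Measurable fun t => condDensity g a t * k (t, a) := (hca a).mul (hka a)
  rw [← lintegral_const_mul _ hck]
  by_cases h0 : ∫⁻ s, g (s, a) = 0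
  · have hz := (lintegral_eq_zero_iff (hga a)).1 h0
    simp only [h0, zero_mul, lintegral_zero]
    have hgk : Measurable fun t => g (t, a) * k (t, a) := (hga a).mul (hka a)
    rw [lintegral_eq_zero_iff hgk]
    filter_upwards [hz] with t ht
    simp only [Pi.zero_apply] at ht ⊢
    simp [ht]
  · refine lintegral_congr fun t => ?_
    rw [condDensity, ← mul_assoc, ENNReal.mul_div_cancel h0 ha]

lemma ae_lintegral_ne_top (hg : Measurable g)
    [IsProbabilityMeasure ((volume.prod ρ).withDensity g)] : ∀ᵐ a ∂ρ, ∫⁻ s, g (s, a) ≠ ∞ := by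
  have h : ∫⁻ a, (∫⁻ s, g (s, a)) ∂ρ = 1 := by
    rw [← lintegral_prod_symm _ hg.aemeasurable, ← setLIntegral_univ,
      ← withDensity_apply _ MeasurableSet.univ, measure_univ]
  filter_upwards [ae_lt_top (hg.lintegral_prod_left' (μ := volume)) (by simp [h])] with a ha
    using ha.ne

lemma ae_isProbabilityMeasure_condDensity (hg : Measurable g)
    [IsProbabilityMeasure ((volume.prod ρ).withDensity g)] :
    ∀ᵐ a ∂ρ.withDensity fun a => ∫⁻ s, g (s, a),
      IsProbabilityMeasure (volume.withDensity (condDensity g a)) := by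
  rw [ae_withDensity_iff hg.lintegral_prod_left']
  filter_upwards [ae_lintegral_ne_top hg] with a ha h0
  exact isProbabilityMeasure_condDensity hg h0 ha

/-- Transporting the fibers monotonically onto the standard Gaussian law makes the first coordinate
independent of the second one. -/
lemma map_fiberTransport (hg : Measurable g)
    [IsProbabilityMeasure ((volume.prod ρ).withDensity g)] :
    ((volume.prod ρ).withDensity g).map (fun p => (fiberTransport g p, p.2)) =
      (gaussianReal 0 1).prod (ρ.withDensity fun a => ∫⁻ s, g (s, a)) := by
  have hm : Measurable fun p : ℝ × α => (fiberTransport g p, p.2) :=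
    (measurable_fiberTransport hg).prodMk measurable_snd
  ext s hs
  rw [Measure.map_apply hm hs, ← lintegral_indicator_one (hm hs),
    lintegral_prod_withDensity hg (ae_lintegral_ne_top hg) (measurable_one.indicator (hm hs)),
    Measure.prod_apply_symm hs]
  refine lintegral_congr_ae ?_
  filter_upwards [ae_isProbabilityMeasure_condDensity hg] with a ha
  have hT : Measurable fun t => gaussianQuantile (cdf (volume.withDensity (condDensity g a)) t) :=
    measurable_gaussianQuantile.comp (continuous_cdf _).measurable
  have hsa : MeasurableSet ((fun y : ℝ => (y, a)) ⁻¹' s) := measurable_prodMk_right hs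
  rw [← map_gaussianQuantile_cdf (volume.withDensity (condDensity g a)),
    Measure.map_apply hT hsa, ← lintegral_indicator_one (hT hsa)]
  refine lintegral_congr fun t => ?_
  change s.indicator 1 (fiberTransport g (t, a), a) =
    s.indicator 1 (gaussianQuantile (cdf (volume.withDensity (condDensity g a)) t), a)
  rw [fiberTransport_eq]

lemma map_snd_prod_withDensity (hg : Measurable g) :
    ((volume.prod ρ).withDensity g).map Prod.snd = ρ.withDensity fun a => ∫⁻ s, g (s, a) := by
  ext s hs
  rw [Measure.map_apply measurable_snd hs, withDensity_apply _ (measurable_snd hs),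
    withDensity_apply _ hs, ← univ_prod, ← Measure.prod_restrict, Measure.restrict_univ,
    lintegral_prod_symm _ hg.aemeasurable]

lemma isProbabilityMeasure_withDensity_lintegral (hg : Measurable g)
    [IsProbabilityMeasure ((volume.prod ρ).withDensity g)] :
    IsProbabilityMeasure (ρ.withDensity fun a => ∫⁻ s, g (s, a)) :=
  map_snd_prod_withDensity (ρ := ρ) hg ▸
    Measure.isProbabilityMeasure_map measurable_snd.aemeasurable

lemma lintegral_gaussianPDF_div_condDensity_le (hg : Measurable g)
    [IsProbabilityMeasure ((volume.prod ρ).withDensity g)]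
    (h2 : Integrable (fun p : ℝ × α => p.1 ^ 2) ((volume.prod ρ).withDensity g)) :
    ∫⁻ p, gaussianPDF 0 1 (fiberTransport g p) / condDensity g p.2 p.1
        ∂(volume.prod ρ).withDensity g ≤
      ENNReal.ofReal (∫ p, p.1 * fiberTransport g p ∂(volume.prod ρ).withDensity g) := by
  have hfin := ae_lintegral_ne_top (ρ := ρ) hg
  have hTm := measurable_fiberTransport hg
  have hcm := measurable_condDensity hg
  have hlaw : ((volume.prod ρ).withDensity g).map (fiberTransport g) = gaussianReal 0 1 := by
    have hpm : Measurable fun p : ℝ × α => (fiberTransport g p, p.2) := hTm.prodMk measurable_snd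
    have := isProbabilityMeasure_withDensity_lintegral (ρ := ρ) hg
    have h := congrArg (Measure.map Prod.fst) (map_fiberTransport (ρ := ρ) hg)
    rwa [Measure.map_map measurable_fst hpm, Measure.map_fst_prod, measure_univ, one_smul] at h
  have hT2 : MemLp (fiberTransport g) 2 ((volume.prod ρ).withDensity g) :=
    (memLp_map_measure_iff aestronglyMeasurable_id hTm.aemeasurable).1
      (hlaw ▸ memLp_id_gaussianReal 2)
  have hX2 : MemLp (fun p : ℝ × α => p.1) 2 ((volume.prod ρ).withDensity g) :=
    (memLp_two_iff_integrable_sq measurable_fst.aestronglyMeasurable).2 h2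
  have hXT : Integrable (fun p : ℝ × α => p.1 * fiberTransport g p)
      ((volume.prod ρ).withDensity g) := hX2.integrable_mul hT2
  have hsq : ∀ᵐ a ∂ρ.withDensity fun a => ∫⁻ s, g (s, a),
      Integrable (fun t : ℝ => t ^ 2) (volume.withDensity (condDensity g a)) := by
    have h := h2.lintegral_lt_top
    rw [lintegral_prod_withDensity hg hfin (by fun_prop)] at h
    have hm : Measurable fun a =>
        ∫⁻ t, ENNReal.ofReal (t ^ 2) ∂volume.withDensity (condDensity g a) := by
      have : ∀ a, ∫⁻ t, ENNReal.ofReal (t ^ 2) ∂volume.withDensity (condDensity g a) =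
          ∫⁻ t, condDensity g a t * ENNReal.ofReal (t ^ 2) := fun a =>
        lintegral_withDensity_eq_lintegral_mul _ (hcm.comp measurable_prodMk_right) (by fun_prop)
      simp_rw [this]
      exact (hcm.mul (g := fun p : ℝ × α => ENNReal.ofReal (p.1 ^ 2))
        (by fun_prop)).lintegral_prod_left'
    filter_upwards [ae_lt_top hm h.ne] with a ha
    refine ⟨by fun_prop, ?_⟩
    rw [hasFiniteIntegral_iff_ofReal (ae_of_all _ fun t => sq_nonneg t)]
    exact ha
  rw [ofReal_integral_eq_lintegral_sub hXT]
  refine ENNReal.le_sub_of_add_le_right hXT.neg.lintegral_lt_top.ne ?_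
  have hm3 : Measurable fun p : ℝ × α =>
      gaussianPDF 0 1 (fiberTransport g p) / condDensity g p.2 p.1 :=
    ((measurable_gaussianPDF 0 1).comp hTm).div hcm
  have hm4 : Measurable fun p : ℝ × α => ENNReal.ofReal (-(p.1 * fiberTransport g p)) := by
    fun_prop
  have hm34 : Measurable fun p : ℝ × α => gaussianPDF 0 1 (fiberTransport g p) /
      condDensity g p.2 p.1 + ENNReal.ofReal (-(p.1 * fiberTransport g p)) := hm3.add hm4
  rw [← lintegral_add_left hm3, lintegral_prod_withDensity hg hfin hm34,
    lintegral_prod_withDensity hg hfin (by fun_prop)]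
  refine lintegral_mono_ae ?_
  filter_upwards [ae_isProbabilityMeasure_condDensity hg, hsq] with a ha hsqa
  refine le_trans ?_ ((lintegral_gaussianPDF_gaussianQuantile_le
    (volume.withDensity (condDensity g a)) hsqa).trans_eq ?_)
  · have hm3a : Measurable fun t => gaussianPDF 0 1 (fiberTransport g (t, a)) / condDensity g a t :=
      hm3.comp measurable_prodMk_right
    rw [lintegral_add_left hm3a]
    simp only [fiberTransport_eq]
    gcongr ?_ + _
    set A : Set ℝ := {t | cdf (volume.withDensity (condDensity g a)) t ∈ Ioo (0 : ℝ) 1}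
    have hA : MeasurableSet A := (continuous_cdf _).measurable measurableSet_Ioo
    have hfull : A =ᵐ[volume.withDensity (condDensity g a)] univ := by
      filter_upwards [ae_cdf_mem_Ioo (volume.withDensity (condDensity g a))] with t ht
      exact propext (iff_true_intro ht)
    have hma : Measurable fun t => gaussianPDF 0 1
        (gaussianQuantile (cdf (volume.withDensity (condDensity g a)) t)) / condDensity g a t := by
      simpa only [fiberTransport_eq] using hm3a
    have hca : Measurable (condDensity g a) := hcm.comp measurable_prodMk_right
    rw [← setLIntegral_univ, ← setLIntegral_congr hfull, restrict_withDensity hA,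
      lintegral_withDensity_eq_lintegral_mul _ hca hma]
    exact lintegral_mono fun t => ENNReal.mul_div_le
  · simp only [fiberTransport_eq]

end Fibered

section Triangular

open ProbabilityTheory hiding stdGaussian
open Set Filter Topology
open scoped ENNReal

lemma MeasureTheory.MeasurePreserving.withDensity_comp {α β : Type*} [MeasurableSpace α]
    [MeasurableSpace β] {μ : Measure α} {ν : Measure β} {φ : α → β} (hφ : MeasurePreserving φ μ ν)
    {k : β → ℝ≥0∞} (hk : Measurable k) :
    MeasurePreserving φ (μ.withDensity (k ∘ φ)) (ν.withDensity k) := by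
  refine ⟨hφ.measurable, ?_⟩
  ext s hs
  rw [Measure.map_apply hφ.measurable hs, withDensity_apply _ (hφ.measurable hs),
    withDensity_apply _ hs, ← hφ.setLIntegral_comp_preimage hs hk]
  rfl

lemma exists_measurableEquiv_pi_succ (n : ℕ) :
    ∃ e : (Fin (n + 1) → ℝ) ≃ᵐ ℝ × (Fin n → ℝ),
      (∀ z, (e z).1 = z 0) ∧ (∀ z i, (e z).2 i = z i.succ) ∧
      (∀ p, e.symm p 0 = p.1) ∧ (∀ p i, e.symm p (Fin.succ i) = p.2 i) ∧
      ∀ ν : Measure ℝ, [SigmaFinite ν] →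
        MeasurePreserving e (Measure.pi fun _ => ν) (ν.prod (Measure.pi fun _ => ν)) :=
  ⟨MeasurableEquiv.piFinSuccAbove (fun _ => ℝ) 0, fun _ => rfl, fun _ _ => rfl,
    fun p => by simp, fun p i => by simp,
    fun ν _ => measurePreserving_piFinSuccAbove (fun _ => ν) 0⟩

/-- The triangular (Knothe-Rosenblatt) transport onto the standard Gaussian. The functions `r i` are
the reciprocals of the diagonal entries of its Jacobian matrix. -/
theorem exists_triangular_transport (n : ℕ) (g : (Fin n → ℝ) → ℝ≥0∞) (hg : Measurable g)
    [hprob : IsProbabilityMeasure (volume.withDensity g)]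
    (h2 : ∀ i, Integrable (fun z : Fin n → ℝ => z i ^ 2) (volume.withDensity g)) :
    ∃ (S : (Fin n → ℝ) → Fin n → ℝ) (r : Fin n → (Fin n → ℝ) → ℝ≥0∞),
      Measurable S ∧ (volume.withDensity g).map S = Measure.pi (fun _ => gaussianReal 0 1) ∧
      (∀ i, Measurable (r i)) ∧
      (∀ᵐ z ∂volume.withDensity g, g z * ∏ i, r i z = ∏ i, gaussianPDF 0 1 (S z i)) ∧
      ∀ i, ∫⁻ z, r i z ∂volume.withDensity g ≤
        ENNReal.ofReal (∫ z, z i * S z i ∂volume.withDensity g) := by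
  induction n with
  | zero =>
    refine ⟨id, fun i => i.elim0, measurable_id, ?_, fun i => i.elim0, ?_, fun i => i.elim0⟩
    · rw [Measure.map_id]
      ext s
      rcases Subsingleton.set_cases (p := fun s => s = ∅ ∨ s = univ) (.inl rfl) (.inr rfl) s
        with rfl | rfl <;> simp
    · have h1 := hprob.measure_univ
      rw [withDensity_apply _ MeasurableSet.univ, setLIntegral_univ,
        Measure.volume_pi_eq_dirac default, lintegral_dirac' _ hg] at h1
      refine ae_of_all _ fun z => ?_
      rw [Subsingleton.elim z default, h1]
      simp
  | succ n ih =>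
    obtain ⟨e, he0, hes, hs0, hss, hpi⟩ := exists_measurableEquiv_pi_succ n
    have hvol : MeasurePreserving e volume (volume.prod volume) := hpi volume
    obtain ⟨k, hkm, hgk⟩ : ∃ k : ℝ × (Fin n → ℝ) → ℝ≥0∞, Measurable k ∧ k ∘ e = g :=
      ⟨g ∘ e.symm, hg.comp e.symm.measurable, by ext z; simp⟩
    have hpres : MeasurePreserving e (volume.withDensity g)
        ((volume.prod volume).withDensity k) := hgk ▸ hvol.withDensity_comp hkm
    have hprobk : IsProbabilityMeasure ((volume.prod volume).withDensity k) :=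
      hpres.map_eq ▸ Measure.isProbabilityMeasure_map hpres.measurable.aemeasurable
    have hmarg := isProbabilityMeasure_withDensity_lintegral (ρ := volume) hkm
    have hk1 : Measurable fun a => ∫⁻ s, k (s, a) := hkm.lintegral_prod_left'
    have hsnd : MeasurePreserving (fun z => (e z).2) (volume.withDensity g)
        (volume.withDensity fun a => ∫⁻ s, k (s, a)) :=
      MeasurePreserving.comp ⟨measurable_snd, map_snd_prod_withDensity hkm⟩ hpres
    obtain ⟨S, r, hS, hlaw, hr, hprod, hcorr⟩ := ih (fun a => ∫⁻ s, k (s, a)) hk1 fun i => by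
      have := h2 i.succ
      refine (hsnd.integrable_comp ((measurable_pi_apply i).pow_const 2).aestronglyMeasurable).1 ?_
      simpa only [Function.comp_def, hes] using this
    have hT := measurable_fiberTransport hkm
    have hrm : Measurable fun p : ℝ × (Fin n → ℝ) =>
        gaussianPDF 0 1 (fiberTransport k p) / condDensity k p.2 p.1 :=
      ((measurable_gaussianPDF 0 1).comp hT).div (measurable_condDensity hkm)
    have hSm : Measurable fun z => e.symm (fiberTransport k (e z), S (e z).2) := by
      fun_prop
    refine ⟨fun z => e.symm (fiberTransport k (e z), S (e z).2),
      Fin.cons (fun z => gaussianPDF 0 1 (fiberTransport k (e z)) / condDensity k (e z).2 (e z).1)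
        (fun i z => r i (e z).2), hSm, ?_, ?_, ?_, ?_⟩
    · have hmid : MeasurePreserving (fun p : ℝ × (Fin n → ℝ) => (fiberTransport k p, p.2))
          ((volume.prod volume).withDensity k)
          ((gaussianReal 0 1).prod (volume.withDensity fun a => ∫⁻ s, k (s, a))) :=
        ⟨hT.prodMk measurable_snd, map_fiberTransport hkm⟩
      have hS' : MeasurePreserving S (volume.withDensity fun a => ∫⁻ s, k (s, a))
          (Measure.pi fun _ => gaussianReal 0 1) := ⟨hS, hlaw⟩
      have hlast := (hpi (gaussianReal 0 1)).symm
      exact (hlast.comp ((((MeasurePreserving.id (gaussianReal 0 1)).prod hS').comp hmid).comp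
        hpres)).map_eq
    · intro i
      refine Fin.cases ?_ (fun j => ?_) i
      · rw [Fin.cons_zero]
        exact hrm.comp e.measurable
      · rw [Fin.cons_succ]
        exact (hr j).comp (measurable_snd.comp e.measurable)
    · have hne0 : ∀ᵐ z ∂volume.withDensity g, g z ≠ 0 := by
        rw [ae_withDensity_iff hg]
        exact ae_of_all _ fun z h => h
      have hnetop : ∀ᵐ z ∂volume.withDensity g, g z ≠ ∞ := by
        refine (withDensity_absolutelyContinuous volume g).ae_le ?_
        have h1 : ∫⁻ z, g z = 1 := by
          rw [← setLIntegral_univ, ← withDensity_apply _ MeasurableSet.univ, measure_univ]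
        filter_upwards [ae_lt_top hg (by simp [h1])] with z hz using hz.ne
      have hm0 : ∀ᵐ a ∂volume.withDensity fun a => ∫⁻ s, k (s, a), ∫⁻ s, k (s, a) ≠ 0 := by
        rw [ae_withDensity_iff hk1]
        exact ae_of_all _ fun z h => h
      have hmtop : ∀ᵐ a ∂volume.withDensity fun a => ∫⁻ s, k (s, a), ∫⁻ s, k (s, a) ≠ ∞ :=
        (withDensity_absolutelyContinuous volume _).ae_le (ae_lintegral_ne_top hkm)
      filter_upwards [hne0, hnetop, hsnd.quasiMeasurePreserving.ae hm0,
        hsnd.quasiMeasurePreserving.ae hmtop, hsnd.quasiMeasurePreserving.ae hprod] with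
        z h1 h2 h3 h4 h5
      have hkz : k (e z) = g z := congrFun hgk z
      rw [Fin.prod_univ_succ, Fin.prod_univ_succ]
      simp only [Fin.cons_zero, Fin.cons_succ, hs0, hss, ← h5]
      rw [condDensity, Prod.mk.eta, hkz]
      rw [← mul_assoc, ← mul_assoc]
      congr 1
      rw [div_eq_mul_inv, ENNReal.inv_div (.inl h4) (.inl h3), mul_left_comm,
        ENNReal.mul_div_cancel h1 h2]
    · intro i
      refine Fin.cases ?_ (fun j => ?_) i
      · simp only [Fin.cons_zero, hs0]
        have h20 : Integrable (fun p : ℝ × (Fin n → ℝ) => p.1 ^ 2)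
            ((volume.prod volume).withDensity k) :=
          (hpres.integrable_comp (by fun_prop)).1
            (by simpa only [Function.comp_def, he0] using h2 0)
        have h := lintegral_gaussianPDF_div_condDensity_le hkm h20
        rw [← hpres.lintegral_comp hrm, ← hpres.integral_comp'] at h
        simpa only [he0] using h
      · simp only [Fin.cons_succ, hss]
        have h := hcorr j
        have hmeas : AEStronglyMeasurable (fun a : Fin n → ℝ => a j * S a j)
            (volume.withDensity fun a => ∫⁻ s, k (s, a)) :=
          Measurable.aestronglyMeasurable (by fun_prop)
        rw [← hsnd.lintegral_comp (hr j), ← hsnd.map_eq,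
          integral_map hsnd.measurable.aemeasurable (hsnd.map_eq ▸ hmeas)] at h
        simpa only [hes] using h

end Triangular

section Gaussian

open ProbabilityTheory hiding stdGaussian
open Set Filter Topology
open scoped ENNReal

lemma volume_withDensity_prod_gaussianPDF (n : ℕ) :
    (volume : Measure (Fin n → ℝ)).withDensity (fun x => ∏ i, gaussianPDF 0 1 (x i)) =
      Measure.pi fun _ => gaussianReal 0 1 := by
  induction n with
  | zero =>
    simp only [Finset.univ_eq_empty, Finset.prod_empty, withDensity_const, one_smul,
      Measure.volume_pi_eq_dirac default, Measure.pi_of_empty _ default]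
  | succ n ih =>
    obtain ⟨e, he0, hes, -, -, hpi⟩ := exists_measurableEquiv_pi_succ n
    have hm : Measurable fun x : Fin n → ℝ => ∏ i, gaussianPDF 0 1 (x i) :=
      Finset.univ.measurable_fun_prod fun i _ =>
        (measurable_gaussianPDF 0 1).comp (measurable_pi_apply i)
    have h1 : MeasurePreserving e volume (volume.prod volume) := hpi volume
    have h2 := h1.withDensity_comp
      (k := fun p => gaussianPDF 0 1 p.1 * ∏ i, gaussianPDF 0 1 (p.2 i))
      (((measurable_gaussianPDF 0 1).comp measurable_fst).mul (hm.comp measurable_snd))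
    rw [← prod_withDensity (measurable_gaussianPDF 0 1) hm, ih,
      ← gaussianReal_of_var_ne_zero 0 one_ne_zero] at h2
    refine e.map_measurableEquiv_injective ?_
    rw [(hpi (gaussianReal 0 1)).map_eq, ← h2.map_eq]
    congr 2
    ext z
    simp [Fin.prod_univ_succ, he0, hes]

lemma stdGaussianDensity_eq_prod (n : ℕ) (x : EuclideanSpace ℝ (Fin n)) :
    stdGaussianDensity n x = ∏ i, gaussianPDFReal 0 1 (x i) := by
  simp only [stdGaussianDensity, gaussianPDFReal, Finset.prod_mul_distrib, ← Real.exp_sum,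
    EuclideanSpace.real_norm_sq_eq]
  congr 1
  · rw [Finset.prod_const, Finset.card_univ, Fintype.card_fin, Real.sqrt_eq_rpow, NNReal.coe_one,
      mul_one, ← Real.rpow_neg (by positivity), ← Real.rpow_mul_natCast (by positivity)]
    congr 1
    ring
  · simp [neg_div, Finset.sum_div]

lemma ofReal_stdGaussianDensity (n : ℕ) (x : EuclideanSpace ℝ (Fin n)) :
    ENNReal.ofReal (stdGaussianDensity n x) = ∏ i, gaussianPDF 0 1 (x i) := by
  rw [stdGaussianDensity_eq_prod, ENNReal.ofReal_prod_of_nonneg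
    fun i _ => gaussianPDFReal_nonneg 0 1 (x i)]
  rfl

lemma log_stdGaussianDensity (n : ℕ) (x : EuclideanSpace ℝ (Fin n)) :
    Real.log (stdGaussianDensity n x) = -(n / 2 * Real.log (2 * π)) - ‖x‖ ^ 2 / 2 := by
  rw [stdGaussianDensity, Real.log_mul (by positivity) (by positivity), Real.log_exp,
    Real.log_rpow (by positivity)]
  ring

lemma continuous_stdGaussianDensity (n : ℕ) : Continuous (stdGaussianDensity n) := by
  unfold stdGaussianDensity
  fun_prop

lemma measurePreserving_ofLp_stdGaussian (n : ℕ) :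
    MeasurePreserving (WithLp.ofLp : EuclideanSpace ℝ (Fin n) → Fin n → ℝ) (stdGaussian n)
      (Measure.pi fun _ => gaussianReal 0 1) := by
  have hm : Measurable fun x : Fin n → ℝ => ∏ i, gaussianPDF 0 1 (x i) :=
    Finset.univ.measurable_fun_prod fun i _ =>
      (measurable_gaussianPDF 0 1).comp (measurable_pi_apply i)
  have h := (PiLp.volume_preserving_ofLp (Fin n)).withDensity_comp hm
  rw [volume_withDensity_prod_gaussianPDF] at h
  have : stdGaussian n = volume.withDensity
      ((fun x : Fin n → ℝ => ∏ i, gaussianPDF 0 1 (x i)) ∘ WithLp.ofLp) := by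
    simp only [stdGaussian, ofReal_stdGaussianDensity]
    rfl
  rwa [this]

lemma measurePreserving_toLp_stdGaussian (n : ℕ) :
    MeasurePreserving (WithLp.toLp 2 : (Fin n → ℝ) → EuclideanSpace ℝ (Fin n))
      (Measure.pi fun _ => gaussianReal 0 1) (stdGaussian n) :=
  MeasurePreserving.symm (MeasurableEquiv.toLp 2 (Fin n → ℝ)).symm
    (measurePreserving_ofLp_stdGaussian n)

instance (n : ℕ) : IsProbabilityMeasure (stdGaussian n) :=
  (measurePreserving_toLp_stdGaussian n).map_eq ▸
    Measure.isProbabilityMeasure_map (measurePreserving_toLp_stdGaussian n).measurable.aemeasurable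

lemma measurePreserving_eval_stdGaussian (n : ℕ) (i : Fin n) :
    MeasurePreserving (fun x : EuclideanSpace ℝ (Fin n) => x i) (stdGaussian n)
      (gaussianReal 0 1) :=
  (measurePreserving_eval (fun _ => gaussianReal 0 1) i).comp (measurePreserving_ofLp_stdGaussian n)

lemma memLp_eval_stdGaussian (n : ℕ) (i : Fin n) :
    MemLp (fun x : EuclideanSpace ℝ (Fin n) => x i) 2 (stdGaussian n) :=
  (memLp_id_gaussianReal 2).comp_measurePreserving (measurePreserving_eval_stdGaussian n i)

lemma integral_eval_stdGaussian (n : ℕ) (i : Fin n) : ∫ x, x i ∂stdGaussian n = 0 := by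
  have h := measurePreserving_eval_stdGaussian n i
  have := integral_map h.measurable.aemeasurable
    (f := fun y => y) (by rw [h.map_eq]; exact aestronglyMeasurable_id)
  rw [← this, h.map_eq, integral_id_gaussianReal]

lemma integral_eval_sq_stdGaussian (n : ℕ) (i : Fin n) : ∫ x, x i ^ 2 ∂stdGaussian n = 1 := by
  have h := measurePreserving_eval_stdGaussian n i
  have h1 := integral_map (μ := stdGaussian n) h.measurable.aemeasurable
    (f := fun y => y ^ 2) (by fun_prop)
  have h2 := variance_of_integral_eq_zero (X := id) (μ := gaussianReal 0 1) aemeasurable_id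
    integral_id_gaussianReal
  rw [← h1, h.map_eq]
  rw [variance_id_gaussianReal] at h2
  simpa using h2.symm

lemma integrable_norm_sq_stdGaussian (n : ℕ) :
    Integrable (fun x => ‖x‖ ^ 2) (stdGaussian n) := by
  simp only [EuclideanSpace.real_norm_sq_eq]
  exact integrable_finsetSum _ fun i _ => (memLp_eval_stdGaussian n i).integrable_sq

lemma integral_norm_sq_stdGaussian (n : ℕ) : ∫ x, ‖x‖ ^ 2 ∂stdGaussian n = n := by
  simp only [EuclideanSpace.real_norm_sq_eq]
  rw [integral_finsetSum _ fun i _ => (memLp_eval_stdGaussian n i).integrable_sq]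
  simp [integral_eval_sq_stdGaussian]

end Gaussian

section Density

open Set Filter Topology
open scoped ENNReal

/-- A density whose logarithm is measurable for the measure it defines may be replaced by a
measurable one. -/
lemma exists_measurable_withDensity_eq {α : Type*} [MeasurableSpace α] {ν μ : Measure α}
    [SFinite ν] [IsFiniteMeasure μ] {f : α → ℝ}
    (hμ : μ = ν.withDensity fun x => ENNReal.ofReal (f x))
    (hlog : AEMeasurable (fun x => Real.log (f x)) μ) :
    ∃ g : α → ℝ≥0∞, Measurable g ∧ μ = ν.withDensity g ∧
      ∀ᵐ x ∂μ, 0 < f x ∧ g x = ENNReal.ofReal (f x) := by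
  obtain ⟨g, hg, hle, hgμ⟩ := exists_measurable_le_withDensity_eq ν fun x => ENNReal.ofReal (f x)
  rw [← hμ] at hgμ
  have hpos : ∀ᵐ x ∂μ, 0 < f x := by
    rw [← hgμ, ae_withDensity_iff hg]
    exact ae_of_all _ fun x hx => ENNReal.ofReal_pos.1 ((pos_iff_ne_zero.2 hx).trans_le (hle x))
  have hf : AEMeasurable f μ :=
    (Real.measurable_exp.comp_aemeasurable hlog).congr
      (hpos.mono fun x hx => Real.exp_log hx)
  obtain ⟨f', hf', hff'⟩ := hf
  set N := toMeasurable μ {x | f x = f' x}ᶜ with hN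
  have hNm : MeasurableSet N := measurableSet_toMeasurable _ _
  have hN0 : μ N = 0 := by rw [hN, measure_toMeasurable]; exact hff'
  have hres : (ν.restrict Nᶜ).withDensity g =
      (ν.restrict Nᶜ).withDensity fun x => ENNReal.ofReal (f' x) := by
    rw [← restrict_withDensity hNm.compl, hgμ, hμ, restrict_withDensity hNm.compl]
    refine withDensity_congr_ae ?_
    filter_upwards [ae_restrict_mem hNm.compl] with x hx
    have : f x = f' x := by
      by_contra h
      exact hx (subset_toMeasurable μ _ h)
    rw [this]
  have hfin : ∫⁻ x, g x ∂ν.restrict Nᶜ ≠ ∞ := by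
    rw [← withDensity_apply _ hNm.compl, hgμ]
    exact measure_ne_top _ _
  have heq := (withDensity_eq_iff hg.aemeasurable (by fun_prop) hfin).1 hres
  rw [Filter.EventuallyEq, ae_restrict_iff' hNm.compl] at heq
  refine ⟨g, hg, hgμ.symm, ?_⟩
  have hac : μ ≪ ν := hμ ▸ withDensity_absolutelyContinuous _ _
  filter_upwards [hpos, hff', hac.ae_le heq, measure_eq_zero_iff_ae_notMem.1 hN0] with x h1 h2 h3 h4
  exact ⟨h1, by rw [h3 h4, h2]⟩

end Density

section Transport

open ProbabilityTheory hiding stdGaussian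
open Set Filter Topology
open scoped ENNReal

lemma exists_triangular_transport_euclidean (n : ℕ) {μ : Measure (EuclideanSpace ℝ (Fin n))}
    [IsProbabilityMeasure μ] {g : EuclideanSpace ℝ (Fin n) → ℝ≥0∞} (hg : Measurable g)
    (hμ : μ = volume.withDensity g) (h2 : Integrable (fun x => ‖x‖ ^ 2) μ) :
    ∃ (S : EuclideanSpace ℝ (Fin n) → EuclideanSpace ℝ (Fin n))
      (r : Fin n → EuclideanSpace ℝ (Fin n) → ℝ≥0∞),
      MeasurePreserving S μ (stdGaussian n) ∧ (∀ i, Measurable (r i)) ∧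
      (∀ᵐ z ∂μ, g z * ∏ i, r i z = ENNReal.ofReal (stdGaussianDensity n (S z))) ∧
      ∀ i, ∫⁻ z, r i z ∂μ ≤ ENNReal.ofReal (∫ z, z i * S z i ∂μ) := by
  have hg' : Measurable (g ∘ WithLp.toLp 2) := hg.comp (WithLp.measurable_toLp 2 _)
  have hpres : MeasurePreserving (WithLp.ofLp : EuclideanSpace ℝ (Fin n) → Fin n → ℝ) μ
      (volume.withDensity (g ∘ WithLp.toLp 2)) := by
    have h := (PiLp.volume_preserving_ofLp (Fin n)).withDensity_comp hg'
    rw [hμ]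
    exact h
  have hprob : IsProbabilityMeasure (volume.withDensity (g ∘ WithLp.toLp 2 : (Fin n → ℝ) → ℝ≥0∞)) :=
    hpres.map_eq ▸ Measure.isProbabilityMeasure_map hpres.measurable.aemeasurable
  have hsq : ∀ i, Integrable (fun z : Fin n → ℝ => z i ^ 2)
      (volume.withDensity (g ∘ WithLp.toLp 2)) := fun i => by
    have hm : AEStronglyMeasurable (fun z : Fin n → ℝ => z i ^ 2)
        (volume.withDensity (g ∘ WithLp.toLp 2)) :=
      ((measurable_pi_apply i).pow_const 2).aestronglyMeasurable
    have hx : Integrable (fun x : EuclideanSpace ℝ (Fin n) => x i ^ 2) μ := by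
      refine h2.mono' (Measurable.aestronglyMeasurable (by fun_prop)) (ae_of_all _ fun x => ?_)
      rw [Real.norm_eq_abs, abs_of_nonneg (sq_nonneg _),
        EuclideanSpace.real_norm_sq_eq]
      exact Finset.single_le_sum (f := fun j => x j ^ 2) (fun j _ => sq_nonneg _)
        (Finset.mem_univ i)
    have hiff := hpres.integrable_comp hm
    exact hiff.1 hx
  obtain ⟨S, r, hS, hlaw, hr, hprod, hcorr⟩ := exists_triangular_transport n _ hg' hsq
  have hSpres : MeasurePreserving S (volume.withDensity (g ∘ WithLp.toLp 2))
      (Measure.pi fun _ => gaussianReal 0 1) := ⟨hS, hlaw⟩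
  refine ⟨fun z => WithLp.toLp 2 (S z.ofLp), fun i z => r i z.ofLp,
    (measurePreserving_toLp_stdGaussian n).comp (hSpres.comp hpres),
    fun i => (hr i).comp hpres.measurable, ?_, fun i => ?_⟩
  · filter_upwards [hpres.quasiMeasurePreserving.ae hprod] with z hz
    rw [ofReal_stdGaussianDensity]
    exact hz
  · have hmeas : AEStronglyMeasurable (fun a : Fin n → ℝ => a i * S a i)
        (volume.withDensity (g ∘ WithLp.toLp 2)) := Measurable.aestronglyMeasurable (by fun_prop)
    have h := hcorr i
    rw [← hpres.lintegral_comp (hr i), ← hpres.map_eq,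
      integral_map hpres.measurable.aemeasurable (hpres.map_eq ▸ hmeas)] at h
    exact h

lemma exp_mul_le_of_pos {x : ℝ} (hx : 0 < x) (a : ℝ) :
    Real.exp a * (1 - a + Real.log x) ≤ x := by
  have h := Real.add_one_le_exp (Real.log x - a)
  rw [Real.exp_sub, Real.exp_log hx, le_div_iff₀ (Real.exp_pos a)] at h
  linarith

lemma MeasureTheory.MemLp.integrable_inner {α E : Type*} [MeasurableSpace α] {μ : Measure α}
    [NormedAddCommGroup E] [InnerProductSpace ℝ E] {X Y : α → E} (hX : MemLp X 2 μ)
    (hY : MemLp Y 2 μ) : Integrable (fun a => inner ℝ (X a) (Y a)) μ :=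
  (hX.integrable_norm_pow two_ne_zero |>.add (hY.integrable_norm_pow two_ne_zero)).mono'
    (hX.1.inner hY.1) (ae_of_all _ fun a => by
      have h1 := norm_inner_le_norm (𝕜 := ℝ) (X a) (Y a)
      have h2 := two_mul_le_add_sq ‖X a‖ ‖Y a‖
      have h3 := mul_nonneg (norm_nonneg (X a)) (norm_nonneg (Y a))
      simp only [Pi.add_apply]
      linarith)

theorem exists_transport_integral_inner_ge {n : ℕ} (hn : 0 < n)
    {μ : Measure (EuclideanSpace ℝ (Fin n))} [IsProbabilityMeasure μ]
    {f : EuclideanSpace ℝ (Fin n) → ℝ} (hμ : μ = volume.withDensity fun x => ENNReal.ofReal (f x))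
    (h2 : Integrable (fun x => ‖x‖ ^ 2) μ) (hlog : Integrable (fun x => Real.log (f x)) μ) :
    ∃ S : EuclideanSpace ℝ (Fin n) → EuclideanSpace ℝ (Fin n),
      MeasurePreserving S μ (stdGaussian n) ∧
      n * Real.exp ((-(n / 2 * Real.log (2 * π)) - n / 2 - ∫ x, Real.log (f x) ∂μ) / n) ≤
        ∫ z, inner ℝ z (S z) ∂μ := by
  obtain ⟨g, hg, hgμ, hfg⟩ := exists_measurable_withDensity_eq hμ hlog.1.aemeasurable
  obtain ⟨S, r, hS, hr, hprod, hcorr⟩ := exists_triangular_transport_euclidean n hg hgμ h2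
  refine ⟨S, hS, ?_⟩
  have hn' : (n : ℝ) ≠ 0 := by positivity
  set L : ℝ := -(n / 2 * Real.log (2 * π)) - n / 2 - ∫ x, Real.log (f x) ∂μ with hL
  have hdens : ∀ x, 0 < stdGaussianDensity n x := fun x => by
    unfold stdGaussianDensity; positivity
  have htop : ∀ i, ∀ᵐ z ∂μ, r i z < ∞ := fun i =>
    ae_lt_top (hr i) ((hcorr i).trans_lt ENNReal.ofReal_lt_top).ne
  have hpos : ∀ᵐ z ∂μ, ∀ i, 0 < r i z := by
    filter_upwards [hprod] with z hz i
    refine pos_iff_ne_zero.2 fun h => ?_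
    rw [Finset.prod_eq_zero (Finset.mem_univ i) h, mul_zero, eq_comm, ENNReal.ofReal_eq_zero] at hz
    exact (hdens _).not_ge hz
  have hRint : ∀ i, Integrable (fun z => (r i z).toReal) μ := fun i =>
    integrable_toReal_of_lintegral_ne_top (hr i).aemeasurable
      ((hcorr i).trans_lt ENNReal.ofReal_lt_top).ne
  have hR : ∀ i, ∫ z, (r i z).toReal ∂μ ≤ ∫ z, z i * S z i ∂μ := fun i => by
    have hc : 0 < ∫ z, z i * S z i ∂μ := by
      refine ENNReal.ofReal_pos.1 (lt_of_lt_of_le (pos_iff_ne_zero.2 fun h => ?_) (hcorr i))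
      rw [lintegral_eq_zero_iff (hr i)] at h
      obtain ⟨z, h1, h2⟩ := (h.and hpos).exists
      exact (h2 i).ne' h1
    rw [integral_toReal (hr i).aemeasurable (htop i)]
    exact ENNReal.toReal_le_of_le_ofReal hc.le (hcorr i)
  have hSn : Integrable (fun z => ‖S z‖ ^ 2) μ :=
    hS.integrable_comp_of_integrable (integrable_norm_sq_stdGaussian n)
  have hSnorm : ∫ z, ‖S z‖ ^ 2 ∂μ = n := by
    have h := integral_map (μ := μ) hS.measurable.aemeasurable
      (f := fun y : EuclideanSpace ℝ (Fin n) => ‖y‖ ^ 2) (by fun_prop)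
    rw [← h, hS.map_eq, integral_norm_sq_stdGaussian]
  have hsum : ∀ᵐ z ∂μ, Real.exp (L / n) * (n * (1 - L / n) + (-(n / 2 * Real.log (2 * π)) -
      ‖S z‖ ^ 2 / 2 - Real.log (f z))) ≤ ∑ i, (r i z).toReal := by
    filter_upwards [hprod, hfg, hpos, ae_all_iff.2 htop] with z h1 h2 h3 h4
    have hri : ∀ i, 0 < (r i z).toReal := fun i => ENNReal.toReal_pos (h3 i).ne' (h4 i).ne
    have h5 := congrArg ENNReal.toReal h1
    rw [h2.2, ENNReal.toReal_mul, ENNReal.toReal_ofReal h2.1.le, ENNReal.toReal_prod,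
      ENNReal.toReal_ofReal (hdens _).le] at h5
    have h6 := congrArg Real.log h5
    rw [Real.log_mul h2.1.ne' (Finset.prod_pos fun i _ => hri i).ne',
      Real.log_prod fun i _ => (hri i).ne', log_stdGaussianDensity] at h6
    have h7 := Finset.sum_le_sum fun i (_ : i ∈ Finset.univ) => exp_mul_le_of_pos (hri i) (L / n)
    rw [← Finset.mul_sum, Finset.sum_add_distrib, Finset.sum_const, Finset.card_univ,
      Fintype.card_fin, nsmul_eq_mul] at h7
    rwa [← h6, add_sub_cancel_left]
  have hint0 : Integrable (fun z => -(n / 2 * Real.log (2 * π)) - ‖S z‖ ^ 2 / 2) μ :=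
    (integrable_const _).sub (hSn.div_const 2)
  have hint1 : Integrable (fun z => -(n / 2 * Real.log (2 * π)) -
      ‖S z‖ ^ 2 / 2 - Real.log (f z)) μ :=
    hint0.sub hlog
  have hval : ∫ z, (-(n / 2 * Real.log (2 * π)) - ‖S z‖ ^ 2 / 2 - Real.log (f z)) ∂μ = L := by
    rw [integral_sub hint0 hlog,
      integral_sub (integrable_const _) (hSn.div_const 2), integral_div, hSnorm]
    simp [hL]
  have hmono := integral_mono_ae (((integrable_const _).add hint1).const_mul _)
    (integrable_finsetSum _ fun i _ => hRint i) hsum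
  simp only [Pi.add_apply] at hmono
  rw [integral_const_mul, integral_add (integrable_const _) hint1, hval,
    integral_finsetSum _ fun i _ => hRint i] at hmono
  have hZ : MemLp (fun z : EuclideanSpace ℝ (Fin n) => z) 2 μ :=
    (memLp_two_iff_integrable_sq_norm (by fun_prop)).2 h2
  have hSL : MemLp S 2 μ :=
    (memLp_two_iff_integrable_sq_norm hS.measurable.aestronglyMeasurable).2 hSn
  have hcoord : ∀ i, Integrable (fun z : EuclideanSpace ℝ (Fin n) => z i * S z i) μ := fun i =>
    (hZ.mono (Measurable.aestronglyMeasurable (by fun_prop))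
      (ae_of_all _ fun z => PiLp.norm_apply_le z i)).integrable_mul
    (hSL.mono (Measurable.aestronglyMeasurable ((by fun_prop :
      Measurable fun z : EuclideanSpace ℝ (Fin n) => z i).comp hS.measurable))
      (ae_of_all _ fun z => PiLp.norm_apply_le (S z) i))
  have hinner : ∫ z, inner ℝ z (S z) ∂μ = ∑ i, ∫ z, z i * S z i ∂μ := by
    rw [← integral_finsetSum _ fun i _ => hcoord i]
    refine integral_congr_ae (ae_of_all _ fun z => ?_)
    simp [PiLp.inner_apply, mul_comm]
  rw [hinner]
  refine le_trans (le_of_eq ?_) (hmono.trans (Finset.sum_le_sum fun i _ => hR i))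
  simp
  field_simp
  ring

end Transport

section Cost

open Set Filter Topology
open scoped ENNReal

lemma sqrt_exp_entropy {n : ℕ} (hn : 0 < n) (I : ℝ) :
    Real.sqrt ((1 / (2 * π * Real.exp 1)) * Real.exp ((2 / n) * (-I))) =
      Real.exp ((-(n / 2 * Real.log (2 * π)) - n / 2 - I) / n) := by
  have hn' : (n : ℝ) ≠ 0 := by positivity
  have h2πe : 2 * π * Real.exp 1 = Real.exp (Real.log (2 * π) + 1) := by
    rw [Real.exp_add, Real.exp_log (by positivity)]
  rw [Real.sqrt_eq_iff_mul_self_eq (by positivity) (by positivity), one_div, ← Real.exp_add,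
    h2πe, ← Real.exp_neg, ← Real.exp_add]
  congr 1
  field_simp
  ring

lemma integral_norm_sub_sq_eq {α E : Type*} [MeasurableSpace α] {μ : Measure α}
    [NormedAddCommGroup E] [InnerProductSpace ℝ E] {X Y : α → E} (hX : MemLp X 2 μ)
    (hY : MemLp Y 2 μ) :
    ∫ a, ‖X a - Y a‖ ^ 2 ∂μ =
      ∫ a, ‖X a‖ ^ 2 ∂μ + ∫ a, ‖Y a‖ ^ 2 ∂μ - 2 * ∫ a, inner ℝ (X a) (Y a) ∂μ := by
  have h1 := hX.integrable_norm_pow two_ne_zero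
  have h2 := hY.integrable_norm_pow two_ne_zero
  have h3 := (hX.integrable_inner hY).const_mul 2
  have h4 : Integrable (fun a => ‖X a‖ ^ 2 - 2 * inner ℝ (X a) (Y a)) μ := h1.sub h3
  simp only [norm_sub_sq_real]
  rw [integral_add h4 h2, integral_sub h1 h3, integral_const_mul]
  ring

variable {n : ℕ} {μ : Measure (EuclideanSpace ℝ (Fin n))}

lemma memLp_of_integrable_norm_sq (h2 : Integrable (fun x => ‖x‖ ^ 2) μ) :
    MemLp (fun x => x) 2 μ :=
  (memLp_two_iff_integrable_sq_norm aestronglyMeasurable_id).2 h2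

/-- The quadratic cost of a coupling with an isotropic Gaussian is at least the one of the affine
transport. -/
lemma le_integral_norm_sub_sq_of_isCoupling {m : EuclideanSpace ℝ (Fin n)} {σ : ℝ} (hσ : 0 < σ)
    (hμ : μ = (stdGaussian n).map fun x => m + σ • x)
    (h2 : Integrable (fun x => ‖x‖ ^ 2) μ)
    {P : Measure (EuclideanSpace ℝ (Fin n) × EuclideanSpace ℝ (Fin n))}
    [IsProbabilityMeasure P] (hP : IsCoupling P μ (stdGaussian n)) :
    ∫ x, ‖x‖ ^ 2 ∂μ + n - 2 * n * σ ≤ ∫ p, ‖p.1 - p.2‖ ^ 2 ∂P := by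
  have h1 : MeasurePreserving Prod.fst P μ := ⟨measurable_fst, hP.1⟩
  have h3 : MeasurePreserving Prod.snd P (stdGaussian n) := ⟨measurable_snd, hP.2⟩
  have hT : Measurable fun x : EuclideanSpace ℝ (Fin n) => m + σ • x := by fun_prop
  have hX : MemLp Prod.fst 2 P := (memLp_of_integrable_norm_sq h2).comp_measurePreserving h1
  have hγ := memLp_of_integrable_norm_sq (integrable_norm_sq_stdGaussian n)
  have hY : MemLp Prod.snd 2 P := hγ.comp_measurePreserving h3
  have : IsProbabilityMeasure μ := hμ ▸ Measure.isProbabilityMeasure_map hT.aemeasurable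
  have hXm : MemLp (fun p => p.1 - m) 2 P := hX.sub (memLp_const m)
  have hX1 : ∫ p, ‖p.1‖ ^ 2 ∂P = ∫ x, ‖x‖ ^ 2 ∂μ := by
    rw [← h1.map_eq, integral_map h1.measurable.aemeasurable (by fun_prop)]
  have hY1 : ∫ p, ‖p.2‖ ^ 2 ∂P = n := by
    rw [← integral_norm_sq_stdGaussian n, ← h3.map_eq,
      integral_map h3.measurable.aemeasurable (by fun_prop)]
  have hXm1 : ∫ p, ‖p.1 - m‖ ^ 2 ∂P = σ ^ 2 * n := by
    have h : ∫ p, ‖p.1 - m‖ ^ 2 ∂P = ∫ x, ‖x - m‖ ^ 2 ∂μ := by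
      rw [← h1.map_eq, integral_map h1.measurable.aemeasurable (by fun_prop)]
    rw [h, hμ, integral_map hT.aemeasurable (by fun_prop), ← integral_norm_sq_stdGaussian n,
      ← integral_const_mul]
    simp [norm_smul, mul_pow]
  have hm1 : ∫ p, inner ℝ m p.2 ∂P = 0 := by
    have h : ∫ p, inner ℝ m p.2 ∂P = ∫ y, inner ℝ m y ∂stdGaussian n := by
      rw [← h3.map_eq, integral_map h3.measurable.aemeasurable (by fun_prop)]
    have hi : ∀ i, Integrable (fun y : EuclideanSpace ℝ (Fin n) => y i * m i) (stdGaussian n) :=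
      fun i => ((memLp_eval_stdGaussian n i).integrable one_le_two).mul_const _
    rw [h]
    simp only [PiLp.inner_apply, RCLike.inner_apply, conj_trivial]
    rw [integral_finsetSum _ fun i _ => hi i]
    simp [integral_mul_const, integral_eval_stdGaussian]
  have hmi : Integrable (fun p : EuclideanSpace ℝ (Fin n) × EuclideanSpace ℝ (Fin n) =>
      inner ℝ m p.2) P := (memLp_const m).integrable_inner hY
  have hi1 := (hXm.integrable_norm_pow two_ne_zero).div_const (2 * σ)
  have hi2 := (hY.integrable_norm_pow two_ne_zero).const_mul (σ / 2)
  have hi3 : Integrable (fun p : EuclideanSpace ℝ (Fin n) × EuclideanSpace ℝ (Fin n) =>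
      inner ℝ m p.2 + ‖p.1 - m‖ ^ 2 / (2 * σ)) P := hmi.add hi1
  have hle : ∫ p, inner ℝ p.1 p.2 ∂P ≤ n * σ := by
    calc ∫ p, inner ℝ p.1 p.2 ∂P
        ≤ ∫ p, (inner ℝ m p.2 + ‖p.1 - m‖ ^ 2 / (2 * σ) + σ / 2 * ‖p.2‖ ^ 2) ∂P := by
          refine integral_mono (hX.integrable_inner hY) (hi3.add hi2) fun p => ?_
          have e1 : inner ℝ p.1 p.2 = inner ℝ m p.2 + inner ℝ (p.1 - m) p.2 := by
            rw [inner_sub_left]; ring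
          have e2 := real_inner_le_norm (p.1 - m) p.2
          have e3 : ‖p.1 - m‖ * ‖p.2‖ ≤ ‖p.1 - m‖ ^ 2 / (2 * σ) + σ / 2 * ‖p.2‖ ^ 2 := by
            have : 0 ≤ (‖p.1 - m‖ - σ * ‖p.2‖) ^ 2 / (2 * σ) := by positivity
            refine sub_nonneg.1 (this.trans_eq ?_)
            field_simp
            ring
          simp only [e1]
          linarith
      _ = n * σ := by
          rw [integral_add hi3 hi2, integral_add hmi hi1, integral_div, integral_const_mul, hm1,
            hXm1, hY1]
          field_simp
          ring
  rw [integral_norm_sub_sq_eq hX hY, hX1, hY1]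
  linarith

lemma map_stdGaussian_eq_withDensity (m : EuclideanSpace ℝ (Fin n)) {σ : ℝ} (hσ : 0 < σ) :
    (stdGaussian n).map (fun x => m + σ • x) =
      volume.withDensity fun x =>
        ENNReal.ofReal ((σ ^ n)⁻¹ * stdGaussianDensity n (σ⁻¹ • (x - m))) := by
  have hT : Measurable fun x : EuclideanSpace ℝ (Fin n) => m + σ • x := by fun_prop
  have hk : Measurable fun x => ENNReal.ofReal (stdGaussianDensity n (σ⁻¹ • (x - m))) := by
    have := continuous_stdGaussianDensity n
    fun_prop
  have hmap : (volume : Measure (EuclideanSpace ℝ (Fin n))).map (fun x => m + σ • x) =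
      ENNReal.ofReal (σ ^ n)⁻¹ • volume := by
    have h := Measure.map_addHaar_smul (volume : Measure (EuclideanSpace ℝ (Fin n))) hσ.ne'
    have hcomp : (fun x : EuclideanSpace ℝ (Fin n) => m + σ • x) =
        (fun x => m + x) ∘ (fun x => σ • x) := rfl
    rw [hcomp, ← Measure.map_map (by fun_prop) (by fun_prop), h, Measure.map_smul,
      map_add_left_eq_self, finrank_euclideanSpace_fin, abs_of_pos (by positivity)]
  have h := (MeasurePreserving.mk hT hmap).withDensity_comp hk
  have hγ : stdGaussian n = volume.withDensity
      ((fun x => ENNReal.ofReal (stdGaussianDensity n (σ⁻¹ • (x - m)))) ∘ fun x => m + σ • x) := by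
    rw [stdGaussian]
    congr 1
    ext x
    simp [smul_smul, hσ.ne']
  rw [hγ, h.map_eq, withDensity_smul_measure, ← withDensity_smul _ hk]
  congr 1
  ext x
  rw [ENNReal.ofReal_mul (by positivity)]
  rfl

lemma integral_log_of_map_stdGaussian {f : EuclideanSpace ℝ (Fin n) → ℝ} [IsProbabilityMeasure μ]
    (hf : μ = volume.withDensity fun x => ENNReal.ofReal (f x))
    (hlog : AEMeasurable (fun x => Real.log (f x)) μ) {m : EuclideanSpace ℝ (Fin n)} {σ : ℝ}
    (hσ : 0 < σ) (hμ : μ = (stdGaussian n).map fun x => m + σ • x) :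
    ∫ x, Real.log (f x) ∂μ = -(n * Real.log σ) - n / 2 * Real.log (2 * π) - n / 2 := by
  obtain ⟨g, hg, hgμ, hfg⟩ := exists_measurable_withDensity_eq hf hlog
  have hT : Measurable fun x : EuclideanSpace ℝ (Fin n) => m + σ • x := by fun_prop
  have hk : Measurable fun x =>
      ENNReal.ofReal ((σ ^ n)⁻¹ * stdGaussianDensity n (σ⁻¹ • (x - m))) := by
    have := continuous_stdGaussianDensity n
    fun_prop
  have hfin : ∫⁻ x, g x ≠ ∞ := by
    rw [← setLIntegral_univ, ← withDensity_apply _ MeasurableSet.univ, ← hgμ]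
    exact measure_ne_top _ _
  have heq := (withDensity_eq_iff hg.aemeasurable hk.aemeasurable hfin).1
    (hgμ.symm.trans (hμ.trans (map_stdGaussian_eq_withDensity m hσ)))
  have hac : μ ≪ volume := hf ▸ withDensity_absolutelyContinuous _ _
  have hdens : ∀ x, 0 < stdGaussianDensity n x := fun x => by
    unfold stdGaussianDensity; positivity
  have hae : (fun x => Real.log (f x)) =ᵐ[μ] fun x =>
      -(n * Real.log σ) - n / 2 * Real.log (2 * π) - ‖σ⁻¹ • (x - m)‖ ^ 2 / 2 := by
    filter_upwards [hfg, hac.ae_le heq] with x h1 h2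
    have hpos : 0 < (σ ^ n)⁻¹ * stdGaussianDensity n (σ⁻¹ • (x - m)) :=
      mul_pos (by positivity) (hdens _)
    have h3 : f x = (σ ^ n)⁻¹ * stdGaussianDensity n (σ⁻¹ • (x - m)) := by
      rw [h1.2] at h2
      exact (ENNReal.ofReal_eq_ofReal_iff h1.1.le hpos.le).1 h2
    rw [h3, Real.log_mul (by positivity) (hdens _).ne', log_stdGaussianDensity, Real.log_inv,
      Real.log_pow]
    ring
  rw [integral_congr_ae hae, hμ, integral_map hT.aemeasurable (by fun_prop)]
  simp only [add_sub_cancel_left, smul_smul, inv_mul_cancel₀ hσ.ne', one_smul]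
  rw [integral_sub (integrable_const _) ((integrable_norm_sq_stdGaussian n).div_const 2),
    integral_div, integral_norm_sq_stdGaussian]
  simp

lemma isCoupling_map_prodMk {ν : Measure (EuclideanSpace ℝ (Fin n))}
    {S : EuclideanSpace ℝ (Fin n) → EuclideanSpace ℝ (Fin n)} (hS : MeasurePreserving S μ ν) :
    IsCoupling (μ.map fun z => (z, S z)) μ ν := by
  have hm : Measurable fun z => (z, S z) := measurable_id.prodMk hS.measurable
  constructor
  · rw [Measure.map_map measurable_fst hm]
    exact Measure.map_id
  · rw [Measure.map_map measurable_snd hm]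
    exact hS.map_eq

/-- There is a coupling whose quadratic cost is bounded by the entropy of the first marginal. -/
theorem exists_isCoupling_integral_norm_sub_sq_le (hn : 0 < n) [IsProbabilityMeasure μ]
    {f : EuclideanSpace ℝ (Fin n) → ℝ} (hμ : μ = volume.withDensity fun x => ENNReal.ofReal (f x))
    (h2 : Integrable (fun x => ‖x‖ ^ 2) μ) (hlog : Integrable (fun x => Real.log (f x)) μ) :
    ∃ P : Measure (EuclideanSpace ℝ (Fin n) × EuclideanSpace ℝ (Fin n)),
      IsProbabilityMeasure P ∧ IsCoupling P μ (stdGaussian n) ∧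
      ∫ p, ‖p.1 - p.2‖ ^ 2 ∂P ≤ ∫ x, ‖x‖ ^ 2 ∂μ + n -
        2 * n * Real.exp ((-(n / 2 * Real.log (2 * π)) - n / 2 - ∫ x, Real.log (f x) ∂μ) / n) := by
  obtain ⟨S, hS, hle⟩ := exists_transport_integral_inner_ge hn hμ h2 hlog
  have hm : Measurable fun z => (z, S z) := measurable_id.prodMk hS.measurable
  refine ⟨μ.map fun z => (z, S z), Measure.isProbabilityMeasure_map hm.aemeasurable,
    isCoupling_map_prodMk hS, ?_⟩
  have hY := (memLp_of_integrable_norm_sq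
    (integrable_norm_sq_stdGaussian n)).comp_measurePreserving hS
  have hSnorm : ∫ z, ‖S z‖ ^ 2 ∂μ = n := by
    rw [← integral_norm_sq_stdGaussian n, ← hS.map_eq,
      integral_map hS.measurable.aemeasurable (by fun_prop)]
  rw [integral_map hm.aemeasurable (by fun_prop)]
  have h := integral_norm_sub_sq_eq (memLp_of_integrable_norm_sq h2) hY
  simp only [Function.comp_apply] at h
  rw [h, hSnorm]
  linarith

end Cost

/-- Sharpened Talagrand inequality: for `P_Y = N(0, Iₙ)`, `P_Z ≪ P_Y` with density `f` and
differential entropy `h(Z) = −∫ ln f dP_Z`,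
`W₂²(P_Z, P_Y) ≤ E[‖Z‖²] + n − 2n √((1/(2πe)) e^{2h(Z)/n})`,
with equality when `P_Z = N(m, σ² Iₙ)` is isotropic Gaussian. -/
theorem stmt14 (n : ℕ) (hn : 0 < n)
    (μZ : Measure (EuclideanSpace ℝ (Fin n))) [IsProbabilityMeasure μZ]
    (f : EuclideanSpace ℝ (Fin n) → ℝ)
    (hμ : μZ = volume.withDensity fun x => ENNReal.ofReal (f x))
    (hac : μZ ≪ stdGaussian n)
    (hE2 : Integrable (fun x => ‖x‖ ^ 2) μZ)
    (hlog : Integrable (fun x => Real.log (f x)) μZ) :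
    sInf {w : ℝ | ∃ P : Measure (EuclideanSpace ℝ (Fin n) × EuclideanSpace ℝ (Fin n)),
        IsProbabilityMeasure P ∧ IsCoupling P μZ (stdGaussian n) ∧
        w = ∫ p, ‖p.1 - p.2‖ ^ 2 ∂P} ≤
      (∫ x, ‖x‖ ^ 2 ∂μZ) + n -
        2 * n * Real.sqrt ((1 / (2 * π * Real.exp 1)) *
          Real.exp ((2 / n) * (-∫ x, Real.log (f x) ∂μZ))) ∧
    (∀ (m : EuclideanSpace ℝ (Fin n)) (σ : ℝ), 0 < σ →
      μZ = (stdGaussian n).map (fun x => m + σ • x) →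
      sInf {w : ℝ | ∃ P : Measure (EuclideanSpace ℝ (Fin n) × EuclideanSpace ℝ (Fin n)),
          IsProbabilityMeasure P ∧ IsCoupling P μZ (stdGaussian n) ∧
          w = ∫ p, ‖p.1 - p.2‖ ^ 2 ∂P} =
        (∫ x, ‖x‖ ^ 2 ∂μZ) + n -
          2 * n * Real.sqrt ((1 / (2 * π * Real.exp 1)) *
            Real.exp ((2 / n) * (-∫ x, Real.log (f x) ∂μZ)))) := by
  rw [sqrt_exp_entropy hn]
  set W := {w : ℝ | ∃ P : Measure (EuclideanSpace ℝ (Fin n) × EuclideanSpace ℝ (Fin n)),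
    IsProbabilityMeasure P ∧ IsCoupling P μZ (stdGaussian n) ∧
    w = ∫ p, ‖p.1 - p.2‖ ^ 2 ∂P}
  obtain ⟨P, hP, hPc, hle⟩ := exists_isCoupling_integral_norm_sub_sq_le hn hμ hE2 hlog
  have hmem : ∫ p, ‖p.1 - p.2‖ ^ 2 ∂P ∈ W := ⟨P, hP, hPc, rfl⟩
  have hbdd : BddBelow W := by
    refine ⟨0, ?_⟩
    rintro w ⟨Q, -, -, rfl⟩
    exact integral_nonneg fun p => sq_nonneg _
  have hupper := (csInf_le hbdd hmem).trans hle
  refine ⟨hupper, fun m σ hσ hm => le_antisymm hupper (le_csInf ⟨_, hmem⟩ ?_)⟩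
  rintro w ⟨Q, hQ, hQc, rfl⟩
  have hn' : (n : ℝ) ≠ 0 := by positivity
  have hexp : (-(n / 2 * Real.log (2 * π)) - n / 2 - ∫ x, Real.log (f x) ∂μZ) / n =
      Real.log σ := by
    rw [integral_log_of_map_stdGaussian hμ hlog.1.aemeasurable hσ hm]
    field_simp
    ring
  rw [hexp, Real.exp_log hσ]
  exact le_integral_norm_sub_sq_of_isCoupling hσ hm hE2 hQc
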